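/- For every integer r ≥ 1, a(r+1) + a(r) = B(r); that is, the number of set partitions of an (r+1)-element set with no singleton blocks plus the number of set partitions of an r-element set with no singleton blocks equals the Bell number B(r). -/

import Mathlib

/-- `B r`: the Bell number, i.e. the number of set partitions of an
`r`-element set. -/
noncomputable def bellNumber (r : ℕ) : ℕ :=
  Nat.card (Finpartition (Finset.univ : Finset (Fin r)))

/-- `a r`: the number of set partitions of an `r`-element set in which every
block has at least two elements. -/
noncomputable def noSingletonPartitionCount (r : ℕ) : ℕ :=
  Nat.card {P : Finpartition (Finset.univ : Finset (Fin r)) //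
    ∀ b ∈ P.parts, 2 ≤ b.card}

namespace Setoid

variable {α β : Type*}

/-- The point `x` is isolated for `s` if it is equivalent only to itself. -/
def IsIsolated (s : Setoid α) (x : α) : Prop := ∀ y, s x y → x = y

/-- Break the class of `none` into singletons and delete `none`. -/
def splitNone (s : Setoid (Option α)) : Setoid α where
  r x y := x = y ∨ s (some x) (some y) ∧ ¬ s none (some x)
  iseqv := by
    have hs := @s.symm'
    have ht := @s.trans'
    exact ⟨fun x => .inl rfl, by grind, by grind⟩

theorem splitNone_rel {s : Setoid (Option α)} {x y : α} :
    s.splitNone x y ↔ x = y ∨ s (some x) (some y) ∧ ¬ s none (some x) := Iff.rfl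

/-- Adjoin `none` and merge it with all isolated points into a single class. -/
def mergeNone (s : Setoid α) : Setoid (Option α) where
  r
    | none, none => True
    | none, some x => s.IsIsolated x
    | some x, none => s.IsIsolated x
    | some x, some y => s x y ∨ s.IsIsolated x ∧ s.IsIsolated y
  iseqv := by
    have hs := @s.symm'
    have ht := @s.trans'
    refine ⟨?_, ?_, ?_⟩
    · rintro (_ | x) <;> simp
    · rintro (_ | x) (_ | y) <;> grind [IsIsolated]
    · rintro (_ | x) (_ | y) (_ | z) <;> grind [IsIsolated]

theorem mergeNone_none_some {s : Setoid α} {x : α} :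
    s.mergeNone none (some x) ↔ s.IsIsolated x := Iff.rfl

theorem mergeNone_some_none {s : Setoid α} {x : α} :
    s.mergeNone (some x) none ↔ s.IsIsolated x := Iff.rfl

theorem mergeNone_some_some {s : Setoid α} {x y : α} :
    s.mergeNone (some x) (some y) ↔ s x y ∨ s.IsIsolated x ∧ s.IsIsolated y := Iff.rfl

theorem isIsolated_splitNone {s : Setoid (Option α)} (h : ∀ x, ¬ s.IsIsolated x) {x : α} :
    s.splitNone.IsIsolated x ↔ s none (some x) := by
  constructor
  · intro hx
    by_contra hn
    refine h (some x) fun y hy => ?_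
    cases y with
    | none => exact (hn (s.symm' hy)).elim
    | some y => rw [hx y (splitNone_rel.2 (.inr ⟨hy, hn⟩))]
  · rintro hx y (rfl | ⟨-, hn⟩)
    exacts [rfl, (hn hx).elim]

theorem exists_isIsolated_splitNone {s : Setoid (Option α)} (h : ∀ x, ¬ s.IsIsolated x) :
    ∃ x, s.splitNone.IsIsolated x := by
  by_contra! hn
  refine h none fun y hy => ?_
  cases y with
  | none => rfl
  | some y => exact (hn y ((isIsolated_splitNone h).2 hy)).elim

theorem not_isIsolated_mergeNone {s : Setoid α} (h : ∃ x, s.IsIsolated x) (x : Option α) :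
    ¬ s.mergeNone.IsIsolated x := by
  intro hx
  cases x with
  | none =>
    obtain ⟨y, hy⟩ := h
    exact Option.some_ne_none y (hx _ (mergeNone_none_some.2 hy)).symm
  | some x =>
    have hi : s.IsIsolated x := fun y hy =>
      Option.some_injective _ (hx _ (mergeNone_some_some.2 (.inl hy)))
    exact Option.some_ne_none x (hx _ (mergeNone_some_none.2 hi))

theorem mergeNone_splitNone {s : Setoid (Option α)} (h : ∀ x, ¬ s.IsIsolated x) :
    s.splitNone.mergeNone = s := by
  have hr := s.refl'
  have hs := @s.symm'
  have ht := @s.trans'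
  ext (_ | x) (_ | y)
  · exact iff_of_true (refl' _ _) (hr _)
  · rw [mergeNone_none_some, isIsolated_splitNone h]
  · rw [mergeNone_some_none, isIsolated_splitNone h]
    exact ⟨hs, hs⟩
  · rw [mergeNone_some_some, isIsolated_splitNone h, isIsolated_splitNone h, splitNone_rel]
    grind

theorem splitNone_mergeNone (s : Setoid α) : s.mergeNone.splitNone = s := by
  have hr := s.refl'
  ext x y
  rw [splitNone_rel, mergeNone_some_some, mergeNone_none_some]
  grind [IsIsolated]

/-- Partitions of `Option α` without singletons correspond to partitions of `α` with at least one
singleton. -/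
def noIsolatedOptionEquiv :
    {s : Setoid (Option α) // ∀ x, ¬ s.IsIsolated x} ≃
      {s : Setoid α // ¬ ∀ x, ¬ s.IsIsolated x} where
  toFun s := ⟨splitNone s.1, not_forall_not.2 (exists_isIsolated_splitNone s.2)⟩
  invFun s := ⟨mergeNone s.1, not_isIsolated_mergeNone (not_forall_not.1 s.2)⟩
  left_inv s := Subtype.ext (mergeNone_splitNone s.2)
  right_inv s := Subtype.ext (splitNone_mergeNone s.1)

theorem isIsolated_comap_equiv (e : α ≃ β) {s : Setoid β} {x : α} :
    (s.comap e).IsIsolated x ↔ s.IsIsolated (e x) := by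
  simp [IsIsolated, comap_rel, e.surjective.forall]

/-- Transport of equivalence relations without isolated points along a bijection. -/
def noIsolatedCongr (e : α ≃ β) :
    {s : Setoid α // ∀ x, ¬ s.IsIsolated x} ≃ {s : Setoid β // ∀ x, ¬ s.IsIsolated x} where
  toFun s := ⟨s.1.comap e.symm, fun _ => mt (isIsolated_comap_equiv e.symm).1 (s.2 _)⟩
  invFun s := ⟨s.1.comap e, fun _ => mt (isIsolated_comap_equiv e).1 (s.2 _)⟩
  left_inv s := by ext; simp [comap_rel]
  right_inv s := by ext; simp [comap_rel]

end Setoid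

namespace Finpartition

variable {α : Type*} [Fintype α] [DecidableEq α]

theorem parts_eq_image_part (P : Finpartition (Finset.univ : Finset α)) :
    P.parts = Finset.univ.image P.part := by
  ext b
  simp only [Finset.mem_image, Finset.mem_univ, true_and]
  constructor
  · intro hb
    obtain ⟨x, hx⟩ := P.nonempty_of_mem_parts hb
    exact ⟨x, P.part_eq_of_mem hb hx⟩
  · rintro ⟨x, rfl⟩
    exact P.part_mem.2 (Finset.mem_univ x)

open Classical in
/-- Finite partitions of a finite type are the same as equivalence relations on it. -/
noncomputable def equivSetoid : Finpartition (Finset.univ : Finset α) ≃ Setoid α where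
  toFun P := Setoid.ker P.part
  invFun s := ofSetoid s
  left_inv P := by
    have h : (ofSetoid (Setoid.ker P.part)).part = P.part := by
      ext x y
      rw [mem_part_ofSetoid_iff_rel, Setoid.ker_def,
        P.mem_part_iff_part_eq_part (Finset.mem_univ y) (Finset.mem_univ x), eq_comm]
    ext1
    rw [parts_eq_image_part, parts_eq_image_part, h]
  right_inv s := by
    ext x y
    rw [Setoid.ker_def, ← mem_part_iff_part_eq_part _ (Finset.mem_univ x) (Finset.mem_univ y),
      mem_part_ofSetoid_iff_rel]
    exact ⟨s.symm', s.symm'⟩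

theorem forall_two_le_card_iff (P : Finpartition (Finset.univ : Finset α)) :
    (∀ b ∈ P.parts, 2 ≤ b.card) ↔ ∀ x, ¬ (equivSetoid P).IsIsolated x := by
  rw [parts_eq_image_part, Finset.forall_mem_image]
  simp only [Finset.mem_univ, true_imp_iff]
  refine forall_congr' fun x => ?_
  have hx : x ∈ P.part x := P.mem_part_self.2 (Finset.mem_univ x)
  have hrel (y : α) : equivSetoid P x y ↔ y ∈ P.part x := by
    rw [P.mem_part_iff_part_eq_part (Finset.mem_univ y) (Finset.mem_univ x), eq_comm]
    rfl
  simp only [Setoid.IsIsolated, hrel, not_forall]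
  rw [Nat.succ_le_iff, Finset.one_lt_card_iff_nontrivial]
  constructor
  · intro h
    obtain ⟨y, hy, hne⟩ := h.exists_ne x
    exact ⟨y, hy, hne.symm⟩
  · rintro ⟨y, hy, hne⟩
    exact ⟨x, hx, y, hy, hne⟩

end Finpartition

theorem noSingletonPartitionCount_eq_card_setoid (r : ℕ) :
    noSingletonPartitionCount r = Nat.card {s : Setoid (Fin r) // ∀ x, ¬ s.IsIsolated x} :=
  Nat.card_congr (Finpartition.equivSetoid.subtypeEquiv Finpartition.forall_two_le_card_iff)

/-- For every integer `r ≥ 1`, `a(r+1) + a(r) = B(r)`: the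
number of set partitions of an `(r+1)`-element set with no singleton blocks
plus the number of set partitions of an `r`-element set with no singleton
blocks equals the Bell number `B(r)`. -/
theorem noSingletonPartitionCount_succ_add
    (r : ℕ) (hr : 1 ≤ r) :
    noSingletonPartitionCount (r + 1) + noSingletonPartitionCount r = bellNumber r := by
  classical
  have : Finite (Setoid (Fin r)) := .of_equiv _ Finpartition.equivSetoid
  rw [noSingletonPartitionCount_eq_card_setoid, noSingletonPartitionCount_eq_card_setoid,
    bellNumber, Nat.card_congr Finpartition.equivSetoid,
    Nat.card_congr ((Setoid.noIsolatedCongr (finSuccEquiv r)).trans Setoid.noIsolatedOptionEquiv),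
    add_comm, ← Nat.card_sum]
  exact Nat.card_congr (Equiv.sumCompl _)
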